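/- Every permutation in s_{123,132}^{2⌊(n−1)/2⌋}(Sₙ) is half-decreasing, and consequently Ord_{s_{123,132}}(Sₙ) ≤ 2⌊(n−1)/2⌋, where Ord is the smallest k such that every element of s^k(Sₙ) is periodic under s_{123,132}. -/

import Mathlib

open scoped Classical

/-- `π` is a permutation of `{1,…,n}` presented as a list. -/
def IsPermOf (n : ℕ) (π : List ℕ) : Prop :=
  π.Perm ((List.range n).map (· + 1))

/-- 1-indexed entry of a list. -/
def ent (π : List ℕ) (i : ℕ) : ℕ := π.getD (i - 1) 0

/-- `a` and `b` are order-isomorphic (same length, same relative order). -/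
def isoBool (a b : List ℕ) : Bool :=
  (a.length == b.length) &&
    (List.range a.length).all fun i =>
      (List.range a.length).all fun j =>
        !(decide (i < j)) ||
          (decide (a.getD i 0 < a.getD j 0) == decide (b.getD i 0 < b.getD j 0))

/-- `l` contains a subsequence order-isomorphic to the pattern `p`. -/
def containsPat (l p : List ℕ) : Bool :=
  l.sublists.any fun t => isoBool t p

/-- One full run of the right-greedy pattern-avoiding stack machine.
`T` is the list of forbidden patterns; the stack is read top-to-bottom
(head = top).  Push is preferred whenever the resulting stack avoids all
patterns in `T`; otherwise the top of the stack is popped to the output.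
At the end the stack is emptied onto the output. -/
def sortRun (T : List (List ℕ)) : List ℕ → List ℕ → List ℕ → List ℕ
  | [], stack, out => out ++ stack
  | x :: rest, stack, out =>
    if T.all (fun p => !containsPat (x :: stack) p) then
      sortRun T rest (x :: stack) out
    else
      match stack with
      | [] => sortRun T rest [x] out
      | y :: st => sortRun T (x :: rest) st (out ++ [y])
termination_by inp stack _ => 2 * inp.length + stack.length
decreasing_by all_goals (simp only [List.length_cons]; omega)

/-- The generalized stack-sorting map `s_T`. -/
def sortT (T : List (List ℕ)) (π : List ℕ) : List ℕ := sortRun T π [] []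

/-- The stack-sorting map `s_{123,132}`. -/
def s132 (π : List ℕ) : List ℕ := sortT [[1, 2, 3], [1, 3, 2]] π

/-- `π_i` is a left-to-right minimum of `π` (1-indexed). -/
def IsLtrMin (π : List ℕ) (i : ℕ) : Prop :=
  1 ≤ i ∧ i ≤ π.length ∧ ∀ m, 1 ≤ m → m ≤ i → ent π i ≤ ent π m

/-- `π_i` is a valley of `π`. -/
def IsValley (π : List ℕ) (i : ℕ) : Prop :=
  IsLtrMin π i ∧ (i + 1 ≤ π.length → ¬ IsLtrMin π (i + 1)) ∧
    (i + 2 ≤ π.length → IsLtrMin π (i + 2))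

/-- Positions `i, i+1, …, i+j` of `π` form a valley-block: `π_{i+j}` is a
valley and `π_i > ⋯ > π_{i+j}` are the `j+1` smallest entries among
`π_1,…,π_{i+j}`. -/
def IsValleyBlock (π : List ℕ) (i j : ℕ) : Prop :=
  1 ≤ i ∧ i + j ≤ π.length ∧ IsValley π (i + j) ∧
    (∀ k, i ≤ k → k < i + j → ent π (k + 1) < ent π k) ∧
    (∀ m, 1 ≤ m → m < i → ent π i < ent π m)

/-- Auxiliary (fuelled) predicate: the positions `i, i+1, …, π.length` of `π`
decompose as an alternation `v̄₁ a₁ v̄₂ a₂ ⋯ v̄_j a_j` of valley-blocks and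
single entries. -/
def AltFromAux (π : List ℕ) : ℕ → ℕ → Prop
  | 0, i => i = π.length + 1
  | fuel + 1, i => i = π.length + 1 ∨
      ∃ j, IsValleyBlock π i j ∧ AltFromAux π fuel (i + j + 2)

/-- The suffix of `π` starting at position `i` is a (nonempty) alternation of
valley-blocks and single entries. -/
def AltDecomp (π : List ℕ) (i : ℕ) : Prop :=
  i ≤ π.length ∧ AltFromAux π (π.length + 1) i

/-- The valley-boundary `𝔅(π)`: the smallest index `i` such that the suffix
`π_i,…,π_n` is an alternation of valley-blocks and single entries, and
`π.length` if no such index exists. -/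
noncomputable def vBoundary (π : List ℕ) : ℕ :=
  if _h : ∃ i, 1 ≤ i ∧ AltDecomp π i then sInf {i | 1 ≤ i ∧ AltDecomp π i}
  else π.length

/-- The value `x` appears in the valley-region `π_{𝔅(π)},…,π_n` of `π`. -/
def InValleyRegion (π : List ℕ) (x : ℕ) : Prop :=
  ∃ i, vBoundary π ≤ i ∧ i ≤ π.length ∧ ent π i = x

/-- `π` is half-decreasing: `π_{n-1}, π_{n-3}, …` (⌊(n−1)/2⌋ entries) is the
identity `1, 2, …, ⌊(n−1)/2⌋`. -/
def HalfDecreasing (π : List ℕ) : Prop :=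
  ∀ k, 1 ≤ k → k ≤ (π.length - 1) / 2 → ent π (π.length + 1 - 2 * k) = k

/-- `π` is periodic under `s_{123,132}`. -/
def PeriodicS (π : List ℕ) : Prop := ∃ k, 1 ≤ k ∧ s132^[k] π = π


/-- The pattern set. -/
abbrev TT : List (List ℕ) := [[1, 2, 3], [1, 3, 2]]

/-- Avoidance of both patterns. -/
def Av (l : List ℕ) : Prop :=
  ∀ a b c, List.Sublist [a, b, c] l → ¬ (a < b ∧ a < c)

/-- `x` may be pushed on top of `st`. -/
def Ok (x : ℕ) (st : List ℕ) : Prop :=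
  st.Pairwise (fun b c => ¬ (x < b ∧ x < c))

theorem iso123 (t : List ℕ) : isoBool t [1, 2, 3] = true ↔
    ∃ a b c, t = [a, b, c] ∧ a < b ∧ a < c ∧ b < c := by
  rcases t with _ | ⟨a, _ | ⟨b, _ | ⟨c, _ | ⟨d, t⟩⟩⟩⟩ <;>
    simp [isoBool, List.range_succ]
  tauto

theorem iso132 (t : List ℕ) : isoBool t [1, 3, 2] = true ↔
    ∃ a b c, t = [a, b, c] ∧ a < b ∧ a < c ∧ c ≤ b := by
  rcases t with _ | ⟨a, _ | ⟨b, _ | ⟨c, _ | ⟨d, t⟩⟩⟩⟩ <;>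
    simp [isoBool, List.range_succ]
  tauto

theorem all_iff (l : List ℕ) :
    (TT.all (fun p => !containsPat l p)) = true ↔ Av l := by
  have h : (TT.all (fun p => !containsPat l p)) = true ↔
      (¬ (containsPat l [1, 2, 3] = true) ∧ ¬ (containsPat l [1, 3, 2] = true)) := by
    simp [TT]
  rw [h]
  unfold containsPat
  rw [List.any_eq_true, List.any_eq_true]
  simp only [iso123, iso132, List.mem_sublists]
  constructor
  · rintro ⟨h1, h2⟩ a b c hs ⟨hb, hc⟩
    rcases lt_or_ge b c with h | h
    · exact h1 ⟨_, hs, a, b, c, rfl, hb, hc, h⟩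
    · exact h2 ⟨_, hs, a, b, c, rfl, hb, hc, h⟩
  · intro h
    constructor
    · rintro ⟨t, hs, a, b, c, rfl, hb, hc, _⟩
      exact h a b c hs ⟨hb, hc⟩
    · rintro ⟨t, hs, a, b, c, rfl, hb, hc, _⟩
      exact h a b c hs ⟨hb, hc⟩

theorem ok_iff (x : ℕ) (st : List ℕ) :
    Ok x st ↔ ∀ b c, List.Sublist [b, c] st → ¬ (x < b ∧ x < c) := by
  unfold Ok
  rw [List.pairwise_iff_forall_sublist]

theorem av_cons (x : ℕ) (st : List ℕ) : Av (x :: st) ↔ Av st ∧ Ok x st := by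
  rw [ok_iff]
  constructor
  · intro h
    exact ⟨fun a b c hs => h a b c (hs.cons _), fun b c hs => h x b c (hs.cons_cons _)⟩
  · rintro ⟨h1, h2⟩ a b c hs
    rw [List.sublist_cons_iff] at hs
    rcases hs with hs | ⟨r, hr, hs⟩
    · exact h1 a b c hs
    · simp only [List.cons.injEq] at hr
      obtain ⟨rfl, rfl⟩ := hr
      exact h2 b c hs

theorem av_nil : Av [] := by
  intro a b c h
  simp at h

theorem ok_single (x y : ℕ) : Ok x [y] := by simp [Ok]

theorem av_single (y : ℕ) : Av [y] := by
  rw [av_cons]; exact ⟨av_nil, by simp [Ok]⟩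

theorem step_push {x : ℕ} {st : List ℕ} (h : Av (x :: st)) (r out : List ℕ) :
    sortRun TT (x :: r) st out = sortRun TT r (x :: st) out := by
  rcases st with _ | ⟨y, st⟩ <;> rw [sortRun, if_pos ((all_iff _).2 h)]

theorem step_pop {x y : ℕ} {st : List ℕ} (h : ¬ Ok x (y :: st)) (r out : List ℕ) :
    sortRun TT (x :: r) (y :: st) out = sortRun TT (x :: r) st (out ++ [y]) := by
  rw [sortRun, if_neg]
  intro h'
  exact h ((av_cons _ _).1 ((all_iff _).1 h')).2

theorem run_perm (N : ℕ) : ∀ r st out : List ℕ, 2 * r.length + st.length ≤ N →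
    ∃ R, sortRun TT r st out = out ++ R ∧ R.Perm (r ++ st) := by
  induction N with
  | zero =>
    intro r st out h
    have h1 : r = [] := List.length_eq_zero_iff.1 (by omega)
    subst h1
    exact ⟨st, by rw [sortRun], by simp⟩
  | succ N ih =>
    intro r st out h
    rcases r with _ | ⟨x, r⟩
    · exact ⟨st, by rw [sortRun], by simp⟩
    · simp only [List.length_cons] at h
      by_cases ha : Av (x :: st)
      · rw [step_push ha]
        obtain ⟨R, h1, h2⟩ := ih r (x :: st) out (by simp only [List.length_cons]; omega)
        exact ⟨R, h1, h2.trans List.perm_middle⟩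
      · rcases st with _ | ⟨y, st⟩
        · exact absurd (av_single x) ha
        · rw [sortRun, if_neg (fun h' => ha ((all_iff _).1 h'))]
          simp only [List.length_cons] at h
          obtain ⟨R, h1, h2⟩ := ih (x :: r) st (out ++ [y])
            (by simp only [List.length_cons]; omega)
          refine ⟨y :: R, ?_, ?_⟩
          · simp [h1]
          · exact (h2.cons y).trans List.perm_middle.symm

theorem run_perm' (r st out : List ℕ) :
    ∃ R, sortRun TT r st out = out ++ R ∧ R.Perm (r ++ st) :=
  run_perm _ r st out le_rfl

theorem s132_perm (l : List ℕ) : (s132 l).Perm l := by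
  obtain ⟨R, h1, h2⟩ := run_perm' l [] []
  show (sortRun TT l [] []).Perm l
  rw [h1]; simpa using h2

theorem popTo (S : List ℕ) (x : ℕ) (hS : Ok x S) : ∀ (T out : List ℕ), Av (T ++ S) →
    ∃ P T', T = P ++ T' ∧ Av (x :: (T' ++ S)) ∧
      ∀ r, sortRun TT (x :: r) (T ++ S) out = sortRun TT r (x :: (T' ++ S)) (out ++ P) := by
  intro T
  induction T with
  | nil =>
    intro out h
    have h' : Av (x :: S) := (av_cons _ _).2 ⟨h, hS⟩
    exact ⟨[], [], rfl, h', fun r => by simpa using step_push h' r out⟩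
  | cons t T ih =>
    intro out h
    by_cases ho : Ok x (t :: (T ++ S))
    · have h' : Av (x :: (t :: T ++ S)) := (av_cons _ _).2 ⟨h, ho⟩
      exact ⟨[], t :: T, rfl, h', fun r => by simpa using step_push h' r out⟩
    · obtain ⟨P, T', h1, h2, h3⟩ := ih (out ++ [t]) ((av_cons _ _).1 h).1
      refine ⟨t :: P, T', by simp [h1], h2, fun r => ?_⟩
      rw [List.cons_append, step_pop ho, h3]
      simp

theorem run_over (S : List ℕ) : ∀ (A : List ℕ), (∀ x ∈ A, Ok x S) → ∀ T out, Av (T ++ S) →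
    ∃ T' out', Av (T' ++ S) ∧ (out' ++ T').Perm (out ++ T ++ A) ∧
      ∀ r, sortRun TT (A ++ r) (T ++ S) out = sortRun TT r (T' ++ S) out' := by
  intro A
  induction A with
  | nil =>
    intro _ T out h
    exact ⟨T, out, h, by simp, fun r => rfl⟩
  | cons x A ih =>
    intro hA T out h
    obtain ⟨P, T1, h1, h2, key⟩ := popTo S x (hA x (by simp)) T out h
    obtain ⟨T', out', h4, h5, h6⟩ := ih (fun z hz => hA z (by simp [hz])) (x :: T1) (out ++ P)
      (by simpa using h2)
    refine ⟨T', out', h4, h5.trans ?_, fun r => ?_⟩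
    · subst h1
      simp only [List.append_assoc]
      refine List.Perm.append_left _ (List.Perm.append_left _ ?_)
      simpa using (List.perm_middle (l₁ := T1) (l₂ := A) (a := x)).symm
    · rw [List.cons_append, key]; simpa using h6 r

theorem popAll (Y y0 : ℕ) (hy0 : Y < y0) : ∀ (T out : List ℕ), (∀ z ∈ T, Y < z) →
    ∀ r, sortRun TT (Y :: r) (T ++ [y0]) out = sortRun TT r [Y, y0] (out ++ T) := by
  intro T
  induction T with
  | nil =>
    intro out _ r
    simpa using step_push ((av_cons Y [y0]).2 ⟨av_single y0, ok_single _ _⟩) r out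
  | cons t T ih =>
    intro out hT r
    have ho : ¬ Ok Y (t :: (T ++ [y0])) := by
      intro ho
      unfold Ok at ho
      rw [List.pairwise_cons] at ho
      exact ho.1 y0 (by simp) ⟨hT t (by simp), hy0⟩
    rw [List.cons_append, step_pop ho, ih _ (fun z hz => hT z (by simp [hz]))]
    simp

theorem s_start (y0 : ℕ) (r : List ℕ) : s132 (y0 :: r) = sortRun TT r [y0] [] := by
  show sortRun TT (y0 :: r) [] [] = _
  rw [step_push (av_single y0)]

/-- State after processing a prefix with bottom `y0`. -/
theorem phase0 (y0 : ℕ) (A : List ℕ) : ∃ T out, (out ++ T).Perm A ∧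
    ∀ r, s132 (y0 :: (A ++ r)) = sortRun TT r (T ++ [y0]) out := by
  obtain ⟨T, out, _, h2, h3⟩ := run_over [y0] A (fun x _ => ok_single _ _) [] [] (av_single y0)
  exact ⟨T, out, by simpa using h2, fun r => by rw [s_start]; exact h3 r⟩

theorem phase1 (y0 : ℕ) (C : List ℕ) (u : ℕ) (E : List ℕ) (hu : u < y0)
    (hC : ∀ z ∈ C, u < z) (hE : ∀ z ∈ E, u < z) : ∃ T out, (out ++ T).Perm (C ++ E) ∧
    ∀ r, s132 (y0 :: (C ++ u :: (E ++ r))) = sortRun TT r (T ++ [u, y0]) out := by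
  obtain ⟨T, out, h2, h3⟩ := phase0 y0 C
  have hT : ∀ z ∈ T, u < z := fun z hz => hC z (h2.subset (by simp [hz]))
  have ok : ∀ x ∈ E, Ok x [u, y0] := by
    intro x hx
    have := hE x hx
    simp only [Ok, List.pairwise_cons, List.mem_singleton, forall_eq]
    refine ⟨fun h => by omega, by simp⟩
  obtain ⟨T', out', _, h5, h6⟩ := run_over [u, y0] E ok [] (out ++ T)
    ((av_cons u [y0]).2 ⟨av_single y0, ok_single _ _⟩)
  refine ⟨T', out', h5.trans ?_, fun r => ?_⟩
  · simpa using h2.append_right E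
  · rw [h3, popAll u y0 hu _ _ hT]
    exact h6 r

theorem F_last (y0 : ℕ) (A : List ℕ) : ∃ O, s132 (y0 :: A) = O ++ [y0] ∧ O.Perm A := by
  obtain ⟨T, out, h2, h3⟩ := phase0 y0 A
  refine ⟨out ++ T, ?_, h2⟩
  have := h3 []
  rw [List.append_nil, sortRun] at this
  simpa using this

theorem F_split (y0 : ℕ) (A : List ℕ) (Y : ℕ) (B : List ℕ) (hy : Y < y0) (hA : ∀ z ∈ A, Y < z) :
    ∃ O R, s132 (y0 :: (A ++ Y :: B)) = O ++ R ∧ O.Perm A ∧ R.Perm (B ++ [Y, y0]) := by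
  obtain ⟨T, out, h2, h3⟩ := phase0 y0 A
  obtain ⟨R, h4, h5⟩ := run_perm' B [Y, y0] (out ++ T)
  refine ⟨out ++ T, R, ?_, h2, h5⟩
  rw [h3, popAll Y y0 hy _ _ (fun z hz => hA z (h2.subset (by simp [hz]))), h4]

theorem F_min_end (y0 : ℕ) (C : List ℕ) (u : ℕ) (E : List ℕ) (hu : u < y0)
    (hC : ∀ z ∈ C, u < z) (hE : ∀ z ∈ E, u < z) :
    ∃ O, s132 (y0 :: (C ++ u :: E)) = O ++ [u, y0] ∧ O.Perm (C ++ E) := by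
  obtain ⟨T, out, h2, h3⟩ := phase1 y0 C u E hu hC hE
  refine ⟨out ++ T, ?_, h2⟩
  have := h3 []
  rw [List.append_nil, sortRun] at this
  simpa using this

theorem F_min (y0 : ℕ) (C : List ℕ) (u : ℕ) (E : List ℕ) (Y : ℕ) (B : List ℕ) (hu : u < y0)
    (hC : ∀ z ∈ C, u < z) (hE : ∀ z ∈ E, u < z) (hY : Y < u) :
    ∃ O R, s132 (y0 :: (C ++ u :: (E ++ Y :: B))) = O ++ u :: R ∧ O.Perm (C ++ E) ∧
      R.Perm (B ++ [Y, y0]) := by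
  obtain ⟨T, out, h2, h3⟩ := phase1 y0 C u E hu hC hE
  have h3' := h3 (Y :: B)
  have e : T ++ [u, y0] = (T ++ [u]) ++ [y0] := by simp
  have hT : ∀ z ∈ T ++ [u], Y < z := by
    intro z hz
    rcases List.mem_append.1 hz with hz | hz
    · have : z ∈ C ++ E := h2.subset (by simp [hz])
      rcases List.mem_append.1 this with h | h
      · exact hY.trans (hC z h)
      · exact hY.trans (hE z h)
    · simp at hz; omega
  rw [e, popAll Y y0 (hY.trans hu) _ _ hT] at h3'
  obtain ⟨R, h4, h5⟩ := run_perm' B [Y, y0] (out ++ (T ++ [u]))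
  refine ⟨out ++ T, R, ?_, h2, h5⟩
  rw [h3', h4]; simp

/-- Number of entries after (the first occurrence of) `x`. -/
def af : List ℕ → ℕ → ℕ
  | [], _ => 0
  | y :: l, x => if y = x then l.length else af l x

theorem af_not_mem {A : List ℕ} {x : ℕ} (h : x ∉ A) (B : List ℕ) : af (A ++ B) x = af B x := by
  induction A with
  | nil => rfl
  | cons a A ih =>
    simp only [List.mem_cons, not_or] at h
    rw [List.cons_append, af, if_neg (fun e => h.1 e.symm), ih h.2]

theorem af_mid {A : List ℕ} {x : ℕ} (h : x ∉ A) (B : List ℕ) :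
    af (A ++ x :: B) x = B.length := by
  rw [af_not_mem h]; simp [af]

theorem af_mem {A : List ℕ} {x : ℕ} (h : x ∈ A) (B : List ℕ) :
    af (A ++ B) x = af A x + B.length := by
  induction A with
  | nil => simp at h
  | cons a A ih =>
    rw [List.cons_append, af, af]
    split_ifs with e
    · simp
    · exact ih (by simpa [Ne.symm e] using h)

theorem af_lt {A : List ℕ} {x : ℕ} (h : x ∈ A) : af A x + 1 ≤ A.length := by
  induction A with
  | nil => simp at h
  | cons a A ih =>
    rw [af]
    split_ifs with e
    · simp
    · have := ih (by simpa [Ne.symm e] using h)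
      simp; omega

/-- Upper bounds on `af` for values up to `t`. -/
def PP (t : ℕ) (l : List ℕ) : Prop := ∀ k, 1 ≤ k → k ≤ t → af l k + 1 ≤ 2 * k

/-- Lower bounds on `af` for values up to `m`. -/
def QQ (m g : ℕ) (l : List ℕ) : Prop := ∀ k, 1 ≤ k → k ≤ m → min (2 * k - 1) g ≤ af l k

theorem perm_mem {n : ℕ} {l : List ℕ} (h : IsPermOf n l) (x : ℕ) : x ∈ l ↔ 1 ≤ x ∧ x ≤ n := by
  rw [h.mem_iff]
  simp only [List.mem_map, List.mem_range]
  constructor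
  · rintro ⟨a, h1, h2⟩; omega
  · rintro ⟨h1, h2⟩; exact ⟨x - 1, by omega, by omega⟩

theorem perm_nodup {n : ℕ} {l : List ℕ} (h : IsPermOf n l) : l.Nodup := by
  unfold IsPermOf at h
  rw [h.nodup_iff]
  exact List.nodup_range.map (fun a b h => by simpa using h)

theorem perm_len {n : ℕ} {l : List ℕ} (h : IsPermOf n l) : l.length = n := by
  simpa using h.length_eq

theorem perm_s {n : ℕ} {l : List ℕ} (h : IsPermOf n l) : IsPermOf n (s132 l) :=
  (s132_perm l).trans h

/-- Split a list at the first entry smaller than `k`. -/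
theorem split_lt (k : ℕ) (l : List ℕ) : (∀ z ∈ l, k ≤ z) ∨
    ∃ A Y B, l = A ++ Y :: B ∧ Y < k ∧ ∀ z ∈ A, k ≤ z := by
  induction l with
  | nil => left; simp
  | cons x l ih =>
    by_cases hx : x < k
    · exact Or.inr ⟨[], x, l, rfl, hx, by simp⟩
    · rcases ih with h | ⟨A, Y, B, h1, h2, h3⟩
      · left
        intro z hz
        rcases List.mem_cons.1 hz with rfl | hz
        · omega
        · exact h z hz
      · right
        refine ⟨x :: A, Y, B, by simp [h1], h2, ?_⟩
        intro z hz
        rcases List.mem_cons.1 hz with rfl | hz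
        · omega
        · exact h3 z hz

theorem le_to_lt {k : ℕ} {A : List ℕ} (h : ∀ z ∈ A, k ≤ z) (hk : k ∉ A) : ∀ z ∈ A, k < z := by
  intro z hz
  rcases (h z hz).lt_or_eq with h' | h'
  · exact h'
  · subst h'; exact absurd hz hk

theorem P_step1 {n k : ℕ} (hk1 : 1 ≤ k) (hk : 2 * k + 1 ≤ n) {l : List ℕ} (hl : IsPermOf n l)
    (hP : PP (k - 1) l) : af (s132 l) k + 1 ≤ 2 * k := by
  have hnd := perm_nodup hl
  have hlen := perm_len hl
  have hmem := perm_mem hl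
  have hnd' := perm_nodup (perm_s hl)
  rcases l with _ | ⟨y0, l⟩
  · simp at hlen; omega
  have hy0 : k ≤ y0 := by
    by_contra hc
    have h1 := (hmem y0).1 (by simp)
    have := hP y0 h1.1 (by omega)
    simp only [af, if_true] at this
    simp only [List.length_cons] at hlen
    omega
  rcases hy0.lt_or_eq with hy0 | rfl
  swap
  · obtain ⟨O, h1, h2⟩ := F_last k l
    rw [h1] at hnd' ⊢
    have : k ∉ O := by
      rw [h2.mem_iff]; exact (List.nodup_cons.1 hnd).1
    rw [af_mid this]; simp; omega
  have hkl : k ∈ l := by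
    have := (hmem k).2 ⟨hk1, by omega⟩
    rcases List.mem_cons.1 this with h | h
    · omega
    · exact h
  have hndl : l.Nodup := (List.nodup_cons.1 hnd).2
  rcases split_lt k l with hall | ⟨A, Y, B, rfl, hY, hA⟩
  · obtain ⟨C, E, rfl⟩ := List.append_of_mem hkl
    have hd := List.nodup_append.1 hndl
    have hkC : k ∉ C := fun h => hd.2.2 k h k (by simp) rfl
    have hkE : k ∉ E := (List.nodup_cons.1 hd.2.1).1
    obtain ⟨O, h1, h2⟩ := F_min_end y0 C k E hy0
      (le_to_lt (fun z hz => hall z (by simp [hz])) hkC)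
      (le_to_lt (fun z hz => hall z (by simp [hz])) hkE)
    have : k ∉ O := by rw [h2.mem_iff]; simp [hkC, hkE]
    rw [h1, af_mid this]; simp; omega
  · have hYA : Y ∉ y0 :: A := by
      intro h
      rcases List.mem_cons.1 h with h | h
      · omega
      · have := hA Y h; omega
    have hYP : B.length + 1 ≤ 2 * Y := by
      have := hP Y ((hmem Y).1 (by simp)).1 (by omega)
      rwa [← List.cons_append, af_mid hYA] at this
    by_cases hkA : k ∈ A
    · obtain ⟨C, E, rfl⟩ := List.append_of_mem hkA
      have hd := List.nodup_append.1 (List.nodup_append.1 hndl).1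
      have hkC : k ∉ C := fun h => hd.2.2 k h k (by simp) rfl
      have hkE : k ∉ E := (List.nodup_cons.1 hd.2.1).1
      obtain ⟨O, R, h1, h2, h3⟩ := F_min y0 C k E Y B hy0
        (le_to_lt (fun z hz => hA z (by simp [hz])) hkC)
        (le_to_lt (fun z hz => hA z (by simp [hz])) hkE) hY
      have : k ∉ O := by rw [h2.mem_iff]; simp [hkC, hkE]
      have h3' := h3.length_eq
      simp only [List.length_append, List.length_cons, List.length_nil] at h3'
      rw [List.append_assoc, List.cons_append, h1, af_mid this]; omega
    · obtain ⟨O, R, h1, h2, h3⟩ := F_split y0 A Y B (by omega)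
        (fun z hz => by have := hA z hz; omega)
      have hkO : k ∉ O := by rwa [h2.mem_iff]
      have hkR : k ∈ R := by
        rw [h3.mem_iff]
        rcases List.mem_append.1 hkl with h | h
        · exact absurd h hkA
        · rcases List.mem_cons.1 h with h | h
          · omega
          · simp [h]
      have h3' := h3.length_eq
      simp only [List.length_append, List.length_cons, List.length_nil] at h3'
      have := af_lt hkR
      rw [h1, af_not_mem hkO]; omega

theorem Q_step1 {n m g k : ℕ} (hm : 2 * m + 1 ≤ n) (hk1 : 1 ≤ k) (hk : k ≤ m) {l : List ℕ}
    (hl : IsPermOf n l) (hP : PP m l) (hQ : QQ m g l) :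
    min (2 * k - 1) (g + 2) ≤ af (s132 l) k := by
  have hnd := perm_nodup hl
  have hlen := perm_len hl
  have hmem := perm_mem hl
  rcases l with _ | ⟨y0, l⟩
  · simp at hlen; omega
  have hy0 : m < y0 := by
    by_contra hc
    have h1 := (hmem y0).1 (by simp)
    have := hP y0 h1.1 (by omega)
    simp only [af, if_true] at this
    simp only [List.length_cons] at hlen
    omega
  have hmem' : ∀ x, 1 ≤ x → x ≤ m → x ∈ l := by
    intro x h1 h2
    have := (hmem x).2 ⟨h1, by omega⟩
    rcases List.mem_cons.1 this with h | h
    · omega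
    · exact h
  have hndl : l.Nodup := (List.nodup_cons.1 hnd).2
  have hpos : ∀ x ∈ l, 1 ≤ x := fun x hx => ((hmem x).1 (by simp [hx])).1
  -- bounds transferred to the tail
  have hafl : ∀ x, x ≤ m → af (y0 :: l) x = af l x := by
    intro x hx
    rw [af, if_neg (by omega)]
  have hP' : ∀ x, 1 ≤ x → x ≤ m → af l x + 1 ≤ 2 * x := by
    intro x h1 h2
    rw [← hafl x h2]; exact hP x h1 h2
  have hQ' : ∀ x, 1 ≤ x → x ≤ m → min (2 * x - 1) g ≤ af l x := by
    intro x h1 h2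
    rw [← hafl x h2]; exact hQ x h1 h2
  obtain ⟨C, D, hCD⟩ := List.append_of_mem (hmem' k hk1 hk)
  have hkC : k ∉ C := by
    rw [hCD] at hndl
    exact fun h => (List.nodup_append.1 hndl).2.2 k h k (by simp) rfl
  have hkD : k ∉ D := by
    rw [hCD] at hndl
    exact (List.nodup_cons.1 (List.nodup_append.1 hndl).2.1).1
  by_cases hmin : ∀ z ∈ C, k < z
  · -- `k` is a left-to-right minimum
    rcases split_lt k D with hall | ⟨E, Y, B, rfl, hY, hE⟩
    · have hk1' : k = 1 := by
        by_contra hne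
        have h1 := hmem' 1 le_rfl (by omega)
        rw [hCD] at h1
        rcases List.mem_append.1 h1 with h | h
        · have := hmin 1 h; omega
        · rcases List.mem_cons.1 h with h | h
          · omega
          · have := hall 1 h; omega
      obtain ⟨O, h1, h2⟩ := F_min_end y0 C k D (by omega) hmin (le_to_lt hall hkD)
      have : k ∉ O := by rw [h2.mem_iff]; simp [hkC, hkD]
      rw [hCD, h1, af_mid this]; simp; omega
    · have hkE : k ∉ E := fun h => hkD (by simp [h])
      obtain ⟨O, R, h1, h2, h3⟩ := F_min y0 C k E Y B (by omega) hmin (le_to_lt hE hkE) hY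
      have : k ∉ O := by rw [h2.mem_iff]; simp [hkC, hkE]
      have h3' := h3.length_eq
      simp only [List.length_append, List.length_cons, List.length_nil] at h3'
      have hY1 : 1 ≤ Y := hpos Y (by rw [hCD]; simp)
      have hq := hQ' (k - 1) (by omega) (by omega)
      have hkm : k - 1 ∉ C ++ k :: E := by
        intro h
        rcases List.mem_append.1 h with h | h
        · have := hmin _ h; omega
        · rcases List.mem_cons.1 h with h | h
          · omega
          · have := hE _ h; omega
      have hin : k - 1 ∈ Y :: B := by
        have h := hmem' (k - 1) (by omega) (by omega)
        rw [hCD] at h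
        have e : C ++ k :: (E ++ Y :: B) = (C ++ k :: E) ++ Y :: B := by simp
        rw [e] at h
        exact (List.mem_append.1 h).resolve_left hkm
      have hb : af l (k - 1) + 1 ≤ B.length + 1 := by
        have e : C ++ k :: (E ++ Y :: B) = (C ++ k :: E) ++ Y :: B := by simp
        rw [hCD, e, af_not_mem hkm]
        simpa using af_lt hin
      rw [hCD, h1, af_mid this]; omega
  · -- let `u < k` be the minimum before `k`
    push Not at hmin
    obtain ⟨z, hzC, hzk⟩ := hmin
    obtain ⟨u, huC, hu⟩ : ∃ u ∈ C, ∀ z ∈ C, u ≤ z := by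
      have hne : C.toFinset.Nonempty := ⟨z, by simpa using hzC⟩
      obtain ⟨u, hu1, hu2⟩ := C.toFinset.exists_min_image id hne
      exact ⟨u, by simpa using hu1, fun z hz => hu2 z (by simpa using hz)⟩
    have huk : u < k := by
      have h1 := hu z hzC
      rcases Nat.lt_or_ge u k with h | h
      · exact h
      · exact absurd (by rw [show k = z by omega]; exact hzC) hkC
    have hu1 : 1 ≤ u := hpos u (by rw [hCD]; simp [huC])
    obtain ⟨C1, C2, rfl⟩ := List.append_of_mem huC
    have hd : (C1 ++ u :: (C2 ++ k :: D)).Nodup := by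
      have := hndl
      rw [hCD] at this
      simpa using this
    have hd' := List.nodup_append.1 hd
    have huC1 : u ∉ C1 := fun h => hd'.2.2 u h u (by simp) rfl
    have hurest : u ∉ C2 ++ k :: D := (List.nodup_cons.1 hd'.2.1).1
    have huC2 : u ∉ C2 := fun h => hurest (by simp [h])
    have hC1 : ∀ z ∈ C1, u < z := le_to_lt (fun z hz => hu z (by simp [hz])) huC1
    have hC2 : ∀ z ∈ C2, u < z := le_to_lt (fun z hz => hu z (by simp [hz])) huC2
    rcases split_lt u D with hall | ⟨E, Y, B, rfl, hY, hE⟩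
    · have huD : u ∉ D := fun h => hurest (by simp [h])
      have hu1' : u = 1 := by
        by_contra hne
        have h1 := hmem' 1 le_rfl (by omega)
        rw [hCD] at h1
        rcases List.mem_append.1 h1 with h | h
        · have := hu 1 h; omega
        · rcases List.mem_cons.1 h with h | h
          · omega
          · have := hall 1 h; omega
      obtain ⟨O, h1, h2⟩ := F_min_end y0 C1 u (C2 ++ k :: D) (by omega) hC1 (by
        intro z hz
        rcases List.mem_append.1 hz with h | h
        · exact hC2 z h
        · rcases List.mem_cons.1 h with h | h
          · omega
          · exact le_to_lt hall huD z h)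
      have hkO : k ∈ O := by rw [h2.mem_iff]; simp
      have e : l = C1 ++ u :: (C2 ++ k :: D) := by rw [hCD]; simp
      have hp := hP' u hu1 (by omega)
      rw [e, af_mid huC1] at hp
      have hq := hQ' k hk1 hk
      rw [hCD, af_mid hkC] at hq
      simp only [List.length_append, List.length_cons] at hp
      rw [e, h1, af_mem hkO]
      simp only [List.length_cons, List.length_nil]
      omega
    · have huE : u ∉ E := fun h => hurest (by simp [h])
      obtain ⟨O, R, h1, h2, h3⟩ := F_min y0 C1 u (C2 ++ k :: E) Y B (by omega) hC1 (by
        intro z hz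
        rcases List.mem_append.1 hz with h | h
        · exact hC2 z h
        · rcases List.mem_cons.1 h with h | h
          · omega
          · exact le_to_lt hE huE z h) hY
      have hkO : k ∈ O := by rw [h2.mem_iff]; simp
      have h3' := h3.length_eq
      simp only [List.length_append, List.length_cons, List.length_nil] at h3'
      have e : l = C1 ++ u :: ((C2 ++ k :: E) ++ Y :: B) := by rw [hCD]; simp
      have e2 : l = (C1 ++ u :: (C2 ++ k :: E)) ++ Y :: B := by rw [hCD]; simp
      have hY1 : 1 ≤ Y := hpos Y (by rw [hCD]; simp)
      have hlow : ∀ x, x < u → x ∉ C1 ++ u :: (C2 ++ k :: E) := by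
        intro x hx h
        simp only [List.mem_append, List.mem_cons] at h
        rcases h with h | h | h | h | h
        · have := hC1 x h; omega
        · omega
        · have := hC2 x h; omega
        · omega
        · have := hE x h; omega
      have hp := hP' u hu1 (by omega)
      have hqu := hQ' u hu1 (by omega)
      rw [e, af_mid huC1] at hp hqu
      have hq := hQ' k hk1 hk
      rw [hCD, af_mid hkC] at hq
      have hpY := hP' Y hY1 (by omega)
      rw [e2, af_mid (hlow Y hY)] at hpY
      have hq1 := hQ' (u - 1) (by omega) (by omega)
      have hin : u - 1 ∈ Y :: B := by
        have h := hmem' (u - 1) (by omega) (by omega)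
        rw [e2] at h
        exact (List.mem_append.1 h).resolve_left (hlow _ (by omega))
      have hb := af_lt hin
      rw [e2, af_not_mem (hlow _ (by omega))] at hq1
      simp only [List.length_append, List.length_cons] at hp hqu hq hb
      rw [e, h1, af_mem hkO]
      simp only [List.length_cons]
      omega

theorem perm_iter {n : ℕ} {l : List ℕ} (h : IsPermOf n l) (t : ℕ) : IsPermOf n (s132^[t] l) := by
  induction t with
  | zero => exact h
  | succ t ih => rw [Function.iterate_succ_apply']; exact perm_s ih

theorem P_iter {n m : ℕ} (hm : 2 * m + 1 ≤ n) {l : List ℕ} (h : IsPermOf n l) (t : ℕ) :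
    PP (min t m) (s132^[t] l) := by
  induction t with
  | zero => intro k h1 h2; omega
  | succ t ih =>
    intro k h1 h2
    rw [Function.iterate_succ_apply']
    exact P_step1 h1 (by omega) (perm_iter h t) (fun j hj1 hj2 => ih j hj1 (by omega))

theorem P_m {n m : ℕ} (hm : 2 * m + 1 ≤ n) {l : List ℕ} (h : IsPermOf n l) (t : ℕ) :
    PP m (s132^[m + t] l) := by
  have := P_iter hm h (m + t)
  rwa [min_eq_right (by omega)] at this

theorem Q_iter {n m : ℕ} (hm : 2 * m + 1 ≤ n) {l : List ℕ} (h : IsPermOf n l) (t : ℕ) :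
    QQ m (2 * t) (s132^[m + t] l) := by
  induction t with
  | zero => intro k _ _; simp
  | succ t ih =>
    intro k h1 h2
    rw [← add_assoc, Function.iterate_succ_apply']
    exact Q_step1 hm h1 h2 (perm_iter h _) (P_m hm h t) ih

/-- Exact version of half-decreasing. -/
def HD (m : ℕ) (l : List ℕ) : Prop := ∀ k, 1 ≤ k → k ≤ m → af l k + 1 = 2 * k

theorem HD_main {n m : ℕ} (hm : 2 * m + 1 ≤ n) {l : List ℕ} (h : IsPermOf n l) :
    HD m (s132^[2 * m] l) := by
  intro k h1 h2
  have hp := P_m hm h m k h1 h2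
  have hq := Q_iter hm h m k h1 h2
  rw [two_mul]
  omega

theorem HD_step {n m : ℕ} (hm : 2 * m + 1 ≤ n) {l : List ℕ} (h : IsPermOf n l) (hd : HD m l) :
    HD m (s132 l) := by
  have hp : PP m l := fun k h1 h2 => (hd k h1 h2).le
  have hq : QQ m (2 * m) l := fun k h1 h2 => by have := hd k h1 h2; omega
  intro k h1 h2
  have a := P_step1 h1 (by omega) h (fun j hj1 hj2 => hp j hj1 (by omega))
  have b := Q_step1 hm h1 h2 h hp hq
  omega

theorem HD_half {n m : ℕ} (hm : m = (n - 1) / 2) {l : List ℕ} (h : IsPermOf n l)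
    (hd : HD m l) : HalfDecreasing l := by
  intro k h1 h2
  have hlen := perm_len h
  rw [hlen] at h2 ⊢
  have hk := hd k h1 (by omega)
  obtain ⟨A, B, rfl⟩ := List.append_of_mem ((perm_mem h k).2 ⟨h1, by omega⟩)
  have hkA : k ∉ A := fun hh => (List.nodup_append.1 (perm_nodup h)).2.2 k hh k (by simp) rfl
  rw [af_mid hkA] at hk
  simp only [List.length_append, List.length_cons] at hlen
  unfold ent
  rw [show n + 1 - 2 * k - 1 = A.length by omega]
  simp [List.getD]

/-- Alternating lists `m, a₁, m-1, a₂, …, 1, a_m`. -/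
inductive Alt : ℕ → List ℕ → Prop
  | nil : Alt 0 []
  | cons (k a : ℕ) (l : List ℕ) : Alt k l → k + 1 < a → Alt (k + 1) ((k + 1) :: a :: l)

/-- Swap consecutive pairs. -/
def swapP : List ℕ → List ℕ
  | x :: a :: l => a :: x :: swapP l
  | [x] => [x]
  | [] => []

theorem swapP_swapP {m : ℕ} {l : List ℕ} (h : Alt m l) : swapP (swapP l) = l := by
  induction h with
  | nil => rfl
  | cons k a l _ _ ih => simp [swapP, ih]

theorem alt_run {m y0 : ℕ} {l : List ℕ} (h : Alt m l) : m < y0 → ∀ out,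
    sortRun TT l [y0] out = out ++ (swapP l ++ [y0]) := by
  induction h with
  | nil => intro _ out; rw [sortRun]; simp [swapP]
  | cons k a l hl ha ih =>
    intro hy out
    have h1 := popAll (k + 1) y0 hy [] out (by simp) (a :: l)
    simp only [List.nil_append, List.append_nil] at h1
    have hav : Av [a, k + 1, y0] := by
      rw [av_cons, av_cons]
      refine ⟨⟨av_single _, ok_single _ _⟩, ?_⟩
      simp only [Ok, List.pairwise_cons, List.mem_singleton, forall_eq]
      exact ⟨fun h => by omega, by simp⟩
    rw [h1, step_push hav]
    cases hl with
    | nil => rw [sortRun]; simp [swapP]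
    | cons k' a' l' hl' ha' =>
      have h2 := popAll (k' + 1) y0 (by omega) [a, k' + 1 + 1] out (by
        intro z hz
        simp at hz
        omega) (a' :: l')
      have h3 := popAll (k' + 1) y0 (by omega) [] (out ++ [a, k' + 1 + 1]) (by simp) (a' :: l')
      simp only [List.nil_append, List.append_nil, List.cons_append] at h2 h3
      rw [h2, ← h3, ih (by omega)]
      simp [swapP]

theorem alt_of (m : ℕ) : ∀ (l : List ℕ), l.length = 2 * m → l.Nodup → (∀ x ∈ l, 1 ≤ x) →
    (∀ k, 1 ≤ k → k ≤ m → k ∈ l ∧ af l k + 1 = 2 * k) → Alt m l := by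
  induction m with
  | zero =>
    intro l h _ _ _
    have : l = [] := List.length_eq_zero_iff.1 (by omega)
    subst this; exact Alt.nil
  | succ m ih =>
    intro l hlen hnd hpos h
    rcases l with _ | ⟨x, _ | ⟨a, l⟩⟩
    · simp at hlen
    · simp at hlen; omega
    simp only [List.length_cons] at hlen
    have hx : x = m + 1 := by
      by_contra hne
      obtain ⟨h1, h2⟩ := h (m + 1) (by omega) le_rfl
      rw [af, if_neg hne] at h2
      have h3 : m + 1 ∈ a :: l := (List.mem_cons.1 h1).resolve_left (Ne.symm hne)
      have := af_lt h3
      simp at this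
      omega
    subst hx
    have ha : m + 1 < a := by
      by_contra hc
      have hne : m + 1 ≠ a := fun e => by
        have := (List.nodup_cons.1 hnd).1
        simp [e] at this
      have h2 := (h a (hpos a (by simp)) (by omega)).2
      rw [af, if_neg hne, af, if_pos rfl] at h2
      omega
    refine Alt.cons m a l (ih l (by omega) ?_ (fun x hx => hpos x (by simp [hx])) ?_) ha
    · exact (List.nodup_cons.1 (List.nodup_cons.1 hnd).2).2
    · intro k h1 h2
      obtain ⟨h3, h4⟩ := h k h1 (by omega)
      rw [af, if_neg (by omega), af, if_neg (by omega)] at h4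
      refine ⟨?_, h4⟩
      rcases List.mem_cons.1 h3 with h | h
      · omega
      · rcases List.mem_cons.1 h with h | h
        · omega
        · exact h

theorem HD_form {n m : ℕ} (hm : m = (n - 1) / 2) (hn : 1 ≤ n) {l : List ℕ} (h : IsPermOf n l)
    (hd : HD m l) : ∃ y0 pre q, l = y0 :: (pre ++ q) ∧ pre.length = n - 1 - 2 * m ∧ Alt m q ∧
      s132 l = pre ++ (swapP q ++ [y0]) := by
  have hlen := perm_len h
  have hnd := perm_nodup h
  have hmem := perm_mem h
  rcases l with _ | ⟨y0, l⟩
  · simp at hlen; omega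
  simp only [List.length_cons] at hlen
  have hbig : ∀ A B, y0 :: l = A ++ B → B.length = 2 * m → ∀ x ∈ A, m < x := by
    intro A B e hB x hx
    by_contra hc
    have h1 := hd x ((hmem x).1 (by rw [e]; simp [hx])).1 (by omega)
    rw [e, af_mem hx] at h1
    omega
  have hlt : l.take (n - 1 - 2 * m) ++ l.drop (n - 1 - 2 * m) = l := List.take_append_drop _ _
  set pre := l.take (n - 1 - 2 * m) with hpre
  set q := l.drop (n - 1 - 2 * m) with hq
  have hlp : pre.length = n - 1 - 2 * m := by rw [hpre, List.length_take]; omega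
  have hlq : q.length = 2 * m := by rw [hq, List.length_drop]; omega
  clear_value pre q
  subst hlt
  have hb := hbig (y0 :: pre) q (by simp) hlq
  have hy0 : m < y0 := hb y0 (by simp)
  have halt : Alt m q := by
    refine alt_of m q hlq ?_ ?_ ?_
    · exact (List.nodup_append.1 (List.nodup_cons.1 hnd).2).2.1
    · intro x hx; exact ((hmem x).1 (by simp [hx])).1
    · intro k h1 h2
      have hk : k ∉ y0 :: pre := fun hh => by have := hb k hh; omega
      have e : y0 :: (pre ++ q) = (y0 :: pre) ++ q := by simp
      constructor
      · have := (hmem k).2 ⟨h1, by omega⟩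
        rw [e] at this
        exact (List.mem_append.1 this).resolve_left hk
      · have := hd k h1 h2
        rwa [e, af_not_mem hk] at this
  refine ⟨y0, pre, q, rfl, hlp, halt, ?_⟩
  rw [s_start]
  rcases pre with _ | ⟨b, _ | ⟨c, pre⟩⟩
  · simpa using alt_run halt hy0 []
  · have hb1 : m < b := hb b (by simp)
    rw [List.cons_append, List.nil_append,
      step_push ((av_cons b [y0]).2 ⟨av_single _, ok_single _ _⟩)]
    have hr := alt_run halt hy0 [b]
    cases halt with
    | nil => rw [sortRun]; simp [swapP]
    | cons k a l' hl ha =>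
      have h2 := popAll (k + 1) y0 hy0 [b] [] (by simpa using hb1) (a :: l')
      have h3 := popAll (k + 1) y0 hy0 [] [b] (by simp) (a :: l')
      simp only [List.nil_append, List.append_nil, List.cons_append] at h2 h3
      rw [h2, ← h3, hr]
  · simp at hlp; omega

theorem s_inj {n m : ℕ} (hm : m = (n - 1) / 2) (hn : 1 ≤ n) {l l' : List ℕ} (h : IsPermOf n l)
    (hd : HD m l) (h' : IsPermOf n l') (hd' : HD m l') (e : s132 l = s132 l') : l = l' := by
  obtain ⟨y, p, q, h1, h2, h3, h4⟩ := HD_form hm hn h hd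
  obtain ⟨y', p', q', h1', h2', h3', h4'⟩ := HD_form hm hn h' hd'
  rw [h4, h4'] at e
  obtain ⟨e1, e2⟩ := List.append_inj e (h2.trans h2'.symm)
  obtain ⟨e3, e4⟩ := List.append_inj' e2 rfl
  have e5 : q = q' := by rw [← swapP_swapP h3, e3, swapP_swapP h3']
  have e6 : y = y' := by simpa using e4
  rw [h1, h1', e1, e5, e6]

theorem HD_periodic {n m : ℕ} (hm : m = (n - 1) / 2) (hn : 1 ≤ n) {l : List ℕ}
    (h : IsPermOf n l) (hd : HD m l) : PeriodicS l := by
  let X : Type := {l : List ℕ // IsPermOf n l ∧ HD m l}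
  have hfin : Finite X := by
    have : {l : List ℕ | IsPermOf n l ∧ HD m l}.Finite := by
      refine (List.finite_toSet (((List.range n).map (· + 1)).permutations)).subset ?_
      rintro l ⟨h1, _⟩
      exact List.mem_permutations.2 h1
    exact this.to_subtype
  let f : X → X := fun x => ⟨s132 x.1, perm_s x.2.1, HD_step (n := n) (by omega) x.2.1 x.2.2⟩
  have hf : Function.Injective f := by
    intro x y e
    have e' : s132 x.1 = s132 y.1 := congrArg Subtype.val e
    exact Subtype.ext (s_inj hm hn x.2.1 x.2.2 y.2.1 y.2.2 e')
  have hper := hf.mem_periodicPts ⟨l, h, hd⟩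
  obtain ⟨k, hk, hk2⟩ := hper
  have hval : ∀ (k : ℕ) (x : X), (f^[k] x).1 = s132^[k] x.1 := by
    intro k
    induction k with
    | zero => intro x; rfl
    | succ k ih => intro x; rw [Function.iterate_succ_apply, Function.iterate_succ_apply, ih]
  refine ⟨k, hk, ?_⟩
  have := congrArg Subtype.val hk2
  rwa [hval] at this

theorem perm_zero {l : List ℕ} (h : IsPermOf 0 l) : l = [] :=
  List.length_eq_zero_iff.1 (perm_len h)

/-- every permutation in `s_{123,132}^{2⌊(n-1)/2⌋}(Sₙ)` is
half-decreasing; consequently all such permutations are periodic, i.e.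
`Ord_{s_{123,132}}(Sₙ) ≤ 2⌊(n-1)/2⌋`. -/
theorem stmt9 (n : ℕ) :
    (∀ π : List ℕ, IsPermOf n π → HalfDecreasing (s132^[2 * ((n - 1) / 2)] π)) ∧
    (∀ π : List ℕ, IsPermOf n π → PeriodicS (s132^[2 * ((n - 1) / 2)] π)) := by
  rcases Nat.eq_zero_or_pos n with rfl | hn
  · constructor
    · intro π h
      have := perm_zero h
      subst this
      intro k h1 h2
      simp at h2
      omega
    · intro π h
      have := perm_zero h
      subst this
      refine ⟨1, le_rfl, ?_⟩
      exact perm_zero (perm_s h)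
  · exact ⟨fun π h => HD_half rfl (perm_iter h _) (HD_main (by omega) h),
      fun π h => HD_periodic rfl hn (perm_iter h _) (HD_main (by omega) h)⟩
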